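/- Let L be a (−1)-class in the del Pezzo lattice of rank 9 (δ = 8), and let B be the set of unordered triples (multisets) {λ₁, λ₂, λ₃} of (−1)-classes satisfying λ₁ + λ₂ + λ₃ = −2K + L. Then the stabilizer of L in the Weyl group W₈ acts on B with exactly four orbits. -/

import Mathlib

/-- A class in the del Pezzo lattice of rank `1 + δ`: the pair `(a, b)`
represents `a·ℓ − b₁e₁ − ⋯ − b_δ e_δ`. -/
abbrev Cls (δ : ℕ) : Type := ℤ × (Fin δ → ℤ)

/-- The intersection product: `(a;b)·(a';b') = a a' − Σ bᵢ bᵢ'`. -/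
def ip {δ : ℕ} (x y : Cls δ) : ℤ := x.1 * y.1 - ∑ i, x.2 i * y.2 i

/-- The canonical class `K = −3ℓ + e₁ + ⋯ + e_δ`, i.e. `(−3; −1, …, −1)`. -/
def Kcls (δ : ℕ) : Cls δ := (-3, fun _ => -1)

/-- A conic class: `Q·Q = 0` and `K·Q = −2`. -/
def IsConic {δ : ℕ} (Q : Cls δ) : Prop := ip Q Q = 0 ∧ ip (Kcls δ) Q = -2

/-- A `(−1)`-class: `L·L = −1` and `K·L = −1`. -/
def IsMinusOne {δ : ℕ} (L : Cls δ) : Prop := ip L L = -1 ∧ ip (Kcls δ) L = -1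

/-- Membership in the Weyl group `W_δ`: a ℤ-linear automorphism of the lattice
preserving the intersection form and fixing the canonical class. -/
def IsWeyl {δ : ℕ} (g : Cls δ ≃ₗ[ℤ] Cls δ) : Prop :=
  (∀ x y : Cls δ, ip (g x) (g y) = ip x y) ∧ g (Kcls δ) = Kcls δ

/-! ### Explicit coordinates -/

/-- A class with explicit coordinates, convenient for evaluation. -/
structure V where
  a : ℤ
  b0 : ℤ
  b1 : ℤ
  b2 : ℤ
  b3 : ℤ
  b4 : ℤ
  b5 : ℤ
  b6 : ℤ
  b7 : ℤ
deriving DecidableEq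

def V.toC (v : V) : Cls 8 := (v.a, ![v.b0, v.b1, v.b2, v.b3, v.b4, v.b5, v.b6, v.b7])

def ipV (v w : V) : ℤ :=
  v.a * w.a - (v.b0 * w.b0 + v.b1 * w.b1 + v.b2 * w.b2 + v.b3 * w.b3 + v.b4 * w.b4
    + v.b5 * w.b5 + v.b6 * w.b6 + v.b7 * w.b7)

theorem ip_toC (v w : V) : ip v.toC w.toC = ipV v w := by
  simp [ip, V.toC, ipV, Fin.sum_univ_eight]

/-- The 240 (−1)-classes. -/
def lits : List V := [
  ⟨0,-1,0,0,0,0,0,0,0⟩, ⟨0,0,-1,0,0,0,0,0,0⟩, ⟨0,0,0,-1,0,0,0,0,0⟩, ⟨0,0,0,0,-1,0,0,0,0⟩,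
  ⟨0,0,0,0,0,-1,0,0,0⟩, ⟨0,0,0,0,0,0,-1,0,0⟩, ⟨0,0,0,0,0,0,0,-1,0⟩, ⟨0,0,0,0,0,0,0,0,-1⟩,
  ⟨1,0,0,0,0,0,0,1,1⟩, ⟨1,0,0,0,0,0,1,0,1⟩, ⟨1,0,0,0,0,0,1,1,0⟩, ⟨1,0,0,0,0,1,0,0,1⟩,
  ⟨1,0,0,0,0,1,0,1,0⟩, ⟨1,0,0,0,0,1,1,0,0⟩, ⟨1,0,0,0,1,0,0,0,1⟩, ⟨1,0,0,0,1,0,0,1,0⟩,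
  ⟨1,0,0,0,1,0,1,0,0⟩, ⟨1,0,0,0,1,1,0,0,0⟩, ⟨1,0,0,1,0,0,0,0,1⟩, ⟨1,0,0,1,0,0,0,1,0⟩,
  ⟨1,0,0,1,0,0,1,0,0⟩, ⟨1,0,0,1,0,1,0,0,0⟩, ⟨1,0,0,1,1,0,0,0,0⟩, ⟨1,0,1,0,0,0,0,0,1⟩,
  ⟨1,0,1,0,0,0,0,1,0⟩, ⟨1,0,1,0,0,0,1,0,0⟩, ⟨1,0,1,0,0,1,0,0,0⟩, ⟨1,0,1,0,1,0,0,0,0⟩,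
  ⟨1,0,1,1,0,0,0,0,0⟩, ⟨1,1,0,0,0,0,0,0,1⟩, ⟨1,1,0,0,0,0,0,1,0⟩, ⟨1,1,0,0,0,0,1,0,0⟩,
  ⟨1,1,0,0,0,1,0,0,0⟩, ⟨1,1,0,0,1,0,0,0,0⟩, ⟨1,1,0,1,0,0,0,0,0⟩, ⟨1,1,1,0,0,0,0,0,0⟩,
  ⟨2,0,0,0,1,1,1,1,1⟩, ⟨2,0,0,1,0,1,1,1,1⟩, ⟨2,0,0,1,1,0,1,1,1⟩, ⟨2,0,0,1,1,1,0,1,1⟩,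
  ⟨2,0,0,1,1,1,1,0,1⟩, ⟨2,0,0,1,1,1,1,1,0⟩, ⟨2,0,1,0,0,1,1,1,1⟩, ⟨2,0,1,0,1,0,1,1,1⟩,
  ⟨2,0,1,0,1,1,0,1,1⟩, ⟨2,0,1,0,1,1,1,0,1⟩, ⟨2,0,1,0,1,1,1,1,0⟩, ⟨2,0,1,1,0,0,1,1,1⟩,
  ⟨2,0,1,1,0,1,0,1,1⟩, ⟨2,0,1,1,0,1,1,0,1⟩, ⟨2,0,1,1,0,1,1,1,0⟩, ⟨2,0,1,1,1,0,0,1,1⟩,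
  ⟨2,0,1,1,1,0,1,0,1⟩, ⟨2,0,1,1,1,0,1,1,0⟩, ⟨2,0,1,1,1,1,0,0,1⟩, ⟨2,0,1,1,1,1,0,1,0⟩,
  ⟨2,0,1,1,1,1,1,0,0⟩, ⟨2,1,0,0,0,1,1,1,1⟩, ⟨2,1,0,0,1,0,1,1,1⟩, ⟨2,1,0,0,1,1,0,1,1⟩,
  ⟨2,1,0,0,1,1,1,0,1⟩, ⟨2,1,0,0,1,1,1,1,0⟩, ⟨2,1,0,1,0,0,1,1,1⟩, ⟨2,1,0,1,0,1,0,1,1⟩,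
  ⟨2,1,0,1,0,1,1,0,1⟩, ⟨2,1,0,1,0,1,1,1,0⟩, ⟨2,1,0,1,1,0,0,1,1⟩, ⟨2,1,0,1,1,0,1,0,1⟩,
  ⟨2,1,0,1,1,0,1,1,0⟩, ⟨2,1,0,1,1,1,0,0,1⟩, ⟨2,1,0,1,1,1,0,1,0⟩, ⟨2,1,0,1,1,1,1,0,0⟩,
  ⟨2,1,1,0,0,0,1,1,1⟩, ⟨2,1,1,0,0,1,0,1,1⟩, ⟨2,1,1,0,0,1,1,0,1⟩, ⟨2,1,1,0,0,1,1,1,0⟩,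
  ⟨2,1,1,0,1,0,0,1,1⟩, ⟨2,1,1,0,1,0,1,0,1⟩, ⟨2,1,1,0,1,0,1,1,0⟩, ⟨2,1,1,0,1,1,0,0,1⟩,
  ⟨2,1,1,0,1,1,0,1,0⟩, ⟨2,1,1,0,1,1,1,0,0⟩, ⟨2,1,1,1,0,0,0,1,1⟩, ⟨2,1,1,1,0,0,1,0,1⟩,
  ⟨2,1,1,1,0,0,1,1,0⟩, ⟨2,1,1,1,0,1,0,0,1⟩, ⟨2,1,1,1,0,1,0,1,0⟩, ⟨2,1,1,1,0,1,1,0,0⟩,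
  ⟨2,1,1,1,1,0,0,0,1⟩, ⟨2,1,1,1,1,0,0,1,0⟩, ⟨2,1,1,1,1,0,1,0,0⟩, ⟨2,1,1,1,1,1,0,0,0⟩,
  ⟨3,0,1,1,1,1,1,1,2⟩, ⟨3,0,1,1,1,1,1,2,1⟩, ⟨3,0,1,1,1,1,2,1,1⟩, ⟨3,0,1,1,1,2,1,1,1⟩,
  ⟨3,0,1,1,2,1,1,1,1⟩, ⟨3,0,1,2,1,1,1,1,1⟩, ⟨3,0,2,1,1,1,1,1,1⟩, ⟨3,1,0,1,1,1,1,1,2⟩,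
  ⟨3,1,0,1,1,1,1,2,1⟩, ⟨3,1,0,1,1,1,2,1,1⟩, ⟨3,1,0,1,1,2,1,1,1⟩, ⟨3,1,0,1,2,1,1,1,1⟩,
  ⟨3,1,0,2,1,1,1,1,1⟩, ⟨3,1,1,0,1,1,1,1,2⟩, ⟨3,1,1,0,1,1,1,2,1⟩, ⟨3,1,1,0,1,1,2,1,1⟩,
  ⟨3,1,1,0,1,2,1,1,1⟩, ⟨3,1,1,0,2,1,1,1,1⟩, ⟨3,1,1,1,0,1,1,1,2⟩, ⟨3,1,1,1,0,1,1,2,1⟩,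
  ⟨3,1,1,1,0,1,2,1,1⟩, ⟨3,1,1,1,0,2,1,1,1⟩, ⟨3,1,1,1,1,0,1,1,2⟩, ⟨3,1,1,1,1,0,1,2,1⟩,
  ⟨3,1,1,1,1,0,2,1,1⟩, ⟨3,1,1,1,1,1,0,1,2⟩, ⟨3,1,1,1,1,1,0,2,1⟩, ⟨3,1,1,1,1,1,1,0,2⟩,
  ⟨3,1,1,1,1,1,1,2,0⟩, ⟨3,1,1,1,1,1,2,0,1⟩, ⟨3,1,1,1,1,1,2,1,0⟩, ⟨3,1,1,1,1,2,0,1,1⟩,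
  ⟨3,1,1,1,1,2,1,0,1⟩, ⟨3,1,1,1,1,2,1,1,0⟩, ⟨3,1,1,1,2,0,1,1,1⟩, ⟨3,1,1,1,2,1,0,1,1⟩,
  ⟨3,1,1,1,2,1,1,0,1⟩, ⟨3,1,1,1,2,1,1,1,0⟩, ⟨3,1,1,2,0,1,1,1,1⟩, ⟨3,1,1,2,1,0,1,1,1⟩,
  ⟨3,1,1,2,1,1,0,1,1⟩, ⟨3,1,1,2,1,1,1,0,1⟩, ⟨3,1,1,2,1,1,1,1,0⟩, ⟨3,1,2,0,1,1,1,1,1⟩,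
  ⟨3,1,2,1,0,1,1,1,1⟩, ⟨3,1,2,1,1,0,1,1,1⟩, ⟨3,1,2,1,1,1,0,1,1⟩, ⟨3,1,2,1,1,1,1,0,1⟩,
  ⟨3,1,2,1,1,1,1,1,0⟩, ⟨3,2,0,1,1,1,1,1,1⟩, ⟨3,2,1,0,1,1,1,1,1⟩, ⟨3,2,1,1,0,1,1,1,1⟩,
  ⟨3,2,1,1,1,0,1,1,1⟩, ⟨3,2,1,1,1,1,0,1,1⟩, ⟨3,2,1,1,1,1,1,0,1⟩, ⟨3,2,1,1,1,1,1,1,0⟩,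
  ⟨4,1,1,1,1,1,2,2,2⟩, ⟨4,1,1,1,1,2,1,2,2⟩, ⟨4,1,1,1,1,2,2,1,2⟩, ⟨4,1,1,1,1,2,2,2,1⟩,
  ⟨4,1,1,1,2,1,1,2,2⟩, ⟨4,1,1,1,2,1,2,1,2⟩, ⟨4,1,1,1,2,1,2,2,1⟩, ⟨4,1,1,1,2,2,1,1,2⟩,
  ⟨4,1,1,1,2,2,1,2,1⟩, ⟨4,1,1,1,2,2,2,1,1⟩, ⟨4,1,1,2,1,1,1,2,2⟩, ⟨4,1,1,2,1,1,2,1,2⟩,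
  ⟨4,1,1,2,1,1,2,2,1⟩, ⟨4,1,1,2,1,2,1,1,2⟩, ⟨4,1,1,2,1,2,1,2,1⟩, ⟨4,1,1,2,1,2,2,1,1⟩,
  ⟨4,1,1,2,2,1,1,1,2⟩, ⟨4,1,1,2,2,1,1,2,1⟩, ⟨4,1,1,2,2,1,2,1,1⟩, ⟨4,1,1,2,2,2,1,1,1⟩,
  ⟨4,1,2,1,1,1,1,2,2⟩, ⟨4,1,2,1,1,1,2,1,2⟩, ⟨4,1,2,1,1,1,2,2,1⟩, ⟨4,1,2,1,1,2,1,1,2⟩,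
  ⟨4,1,2,1,1,2,1,2,1⟩, ⟨4,1,2,1,1,2,2,1,1⟩, ⟨4,1,2,1,2,1,1,1,2⟩, ⟨4,1,2,1,2,1,1,2,1⟩,
  ⟨4,1,2,1,2,1,2,1,1⟩, ⟨4,1,2,1,2,2,1,1,1⟩, ⟨4,1,2,2,1,1,1,1,2⟩, ⟨4,1,2,2,1,1,1,2,1⟩,
  ⟨4,1,2,2,1,1,2,1,1⟩, ⟨4,1,2,2,1,2,1,1,1⟩, ⟨4,1,2,2,2,1,1,1,1⟩, ⟨4,2,1,1,1,1,1,2,2⟩,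
  ⟨4,2,1,1,1,1,2,1,2⟩, ⟨4,2,1,1,1,1,2,2,1⟩, ⟨4,2,1,1,1,2,1,1,2⟩, ⟨4,2,1,1,1,2,1,2,1⟩,
  ⟨4,2,1,1,1,2,2,1,1⟩, ⟨4,2,1,1,2,1,1,1,2⟩, ⟨4,2,1,1,2,1,1,2,1⟩, ⟨4,2,1,1,2,1,2,1,1⟩,
  ⟨4,2,1,1,2,2,1,1,1⟩, ⟨4,2,1,2,1,1,1,1,2⟩, ⟨4,2,1,2,1,1,1,2,1⟩, ⟨4,2,1,2,1,1,2,1,1⟩,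
  ⟨4,2,1,2,1,2,1,1,1⟩, ⟨4,2,1,2,2,1,1,1,1⟩, ⟨4,2,2,1,1,1,1,1,2⟩, ⟨4,2,2,1,1,1,1,2,1⟩,
  ⟨4,2,2,1,1,1,2,1,1⟩, ⟨4,2,2,1,1,2,1,1,1⟩, ⟨4,2,2,1,2,1,1,1,1⟩, ⟨4,2,2,2,1,1,1,1,1⟩,
  ⟨5,1,1,2,2,2,2,2,2⟩, ⟨5,1,2,1,2,2,2,2,2⟩, ⟨5,1,2,2,1,2,2,2,2⟩, ⟨5,1,2,2,2,1,2,2,2⟩,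
  ⟨5,1,2,2,2,2,1,2,2⟩, ⟨5,1,2,2,2,2,2,1,2⟩, ⟨5,1,2,2,2,2,2,2,1⟩, ⟨5,2,1,1,2,2,2,2,2⟩,
  ⟨5,2,1,2,1,2,2,2,2⟩, ⟨5,2,1,2,2,1,2,2,2⟩, ⟨5,2,1,2,2,2,1,2,2⟩, ⟨5,2,1,2,2,2,2,1,2⟩,
  ⟨5,2,1,2,2,2,2,2,1⟩, ⟨5,2,2,1,1,2,2,2,2⟩, ⟨5,2,2,1,2,1,2,2,2⟩, ⟨5,2,2,1,2,2,1,2,2⟩,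
  ⟨5,2,2,1,2,2,2,1,2⟩, ⟨5,2,2,1,2,2,2,2,1⟩, ⟨5,2,2,2,1,1,2,2,2⟩, ⟨5,2,2,2,1,2,1,2,2⟩,
  ⟨5,2,2,2,1,2,2,1,2⟩, ⟨5,2,2,2,1,2,2,2,1⟩, ⟨5,2,2,2,2,1,1,2,2⟩, ⟨5,2,2,2,2,1,2,1,2⟩,
  ⟨5,2,2,2,2,1,2,2,1⟩, ⟨5,2,2,2,2,2,1,1,2⟩, ⟨5,2,2,2,2,2,1,2,1⟩, ⟨5,2,2,2,2,2,2,1,1⟩,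
  ⟨6,2,2,2,2,2,2,2,3⟩, ⟨6,2,2,2,2,2,2,3,2⟩, ⟨6,2,2,2,2,2,3,2,2⟩, ⟨6,2,2,2,2,3,2,2,2⟩,
  ⟨6,2,2,2,3,2,2,2,2⟩, ⟨6,2,2,3,2,2,2,2,2⟩, ⟨6,2,3,2,2,2,2,2,2⟩, ⟨6,3,2,2,2,2,2,2,2⟩]

def KV : V := ⟨-3, -1, -1, -1, -1, -1, -1, -1, -1⟩

theorem KV_toC : KV.toC = Kcls 8 := by
  simp only [KV, V.toC, Kcls]
  congr 1
  funext i
  fin_cases i <;> rfl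

def rng : List ℤ := [-7, -6, -5, -4, -3, -2, -1, 0, 1, 2, 3, 4, 5, 6, 7]

/-- Vectors of length `n` with sum `s` and sum of squares `q`. -/
def vecs : ℕ → ℤ → ℤ → List (List ℤ)
  | 0, _, _ => [[]]
  | n + 1, s, q =>
    if s * s ≤ (n + 1 : ℕ) * q then
      rng.flatMap fun b => (vecs n (s - b) (q - b * b)).map (b :: ·)
    else []

theorem mem_rng (b : ℤ) (h : b * b ≤ 50) : b ∈ rng := by
  have h1 : b ≤ 7 := by nlinarith
  have h2 : -7 ≤ b := by nlinarith
  interval_cases b <;> decide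

theorem mem_vecs : ∀ (n : ℕ) (f : Fin n → ℤ), ∑ i, f i * f i ≤ 50 →
    List.ofFn f ∈ vecs n (∑ i, f i) (∑ i, f i * f i)
  | 0, f, _ => by simp [vecs]
  | n + 1, f, h => by
    have hc : (∑ i, f i) * (∑ i, f i) ≤ (n + 1 : ℕ) * ∑ i, f i * f i := by
      have := sq_sum_le_card_mul_sum_sq (s := Finset.univ) (f := f)
      simpa [sq] using this
    rw [vecs, if_pos hc, List.mem_flatMap]
    rw [Fin.sum_univ_succ] at h
    have hn : 0 ≤ ∑ i : Fin n, f i.succ * f i.succ :=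
      Finset.sum_nonneg fun i _ => mul_self_nonneg _
    have h0 := mul_self_nonneg (f 0)
    refine ⟨f 0, mem_rng _ (by linarith), ?_⟩
    rw [List.ofFn_succ, List.mem_map]
    refine ⟨_, ?_, rfl⟩
    have := mem_vecs n (fun i => f i.succ) (by linarith)
    rw [Fin.sum_univ_succ, Fin.sum_univ_succ]
    simpa using this

def enumCheck : Bool :=
  [(-1 : ℤ), 0, 1, 2, 3, 4, 5, 6, 7].all fun a =>
    (vecs 8 (3 * a - 1) (a * a + 1)).all fun l =>
      -- the innermost test of the sums is only made at the end
      !(decide (l.sum = 3 * a - 1) && decide ((l.map fun b => b * b).sum = a * a + 1)) ||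
      lits.any fun v => decide (v.a = a) &&
        decide ([v.b0, v.b1, v.b2, v.b3, v.b4, v.b5, v.b6, v.b7] = l)

set_option maxRecDepth 100000 in
theorem enumCheck_true : enumCheck = true := by decide +kernel

theorem mem_lits (x : Cls 8) (hx : IsMinusOne x) : ∃ v ∈ lits, x = v.toC := by
  obtain ⟨a, b⟩ := x
  obtain ⟨h1, h2⟩ := hx
  simp only [ip, Kcls] at h1 h2
  have hs : ∑ i, b i = 3 * a - 1 := by
    simp only [neg_mul, one_mul, Finset.sum_neg_distrib] at h2
    linarith
  have hq : ∑ i, b i * b i = a * a + 1 := by linarith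
  have hc : (∑ i, b i) ^ 2 ≤ 8 * ∑ i, b i * b i := by
    have := sq_sum_le_card_mul_sum_sq (s := Finset.univ) (f := b)
    simpa [sq] using this
  rw [hs, hq] at hc
  have ha1 : a ≤ 7 := by nlinarith
  have ha2 : -1 ≤ a := by nlinarith
  have hm := mem_vecs 8 b (by rw [hq]; nlinarith)
  rw [hs, hq] at hm
  have hE := enumCheck_true
  rw [enumCheck, List.all_eq_true] at hE
  have hE := hE a (by interval_cases a <;> decide)
  rw [List.all_eq_true] at hE
  have hE := hE _ hm
  have e1 : (List.ofFn b).sum = 3 * a - 1 := by rw [List.sum_ofFn, hs]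
  have e2 : ((List.ofFn b).map fun b => b * b).sum = a * a + 1 := by
    rw [List.map_ofFn, List.sum_ofFn, ← hq]; rfl
  simp only [e1, e2, decide_true, Bool.and_self, Bool.not_true, Bool.false_or,
    List.any_eq_true, Bool.and_eq_true, decide_eq_true_eq] at hE
  obtain ⟨v, hv, hva, hvl⟩ := hE
  refine ⟨v, hv, ?_⟩
  simp only [V.toC, hva]
  congr 1
  simp [List.ofFn_succ] at hvl
  obtain ⟨r0, r1, r2, r3, r4, r5, r6, r7⟩ := hvl
  funext i
  fin_cases i <;> simp [r0, r1, r2, r3, r4, r5, r6, r7]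

theorem lits_minusOne : ∀ v ∈ lits, IsMinusOne v.toC := by
  have h : (lits.all fun v => decide (ipV v v = -1) && decide (ipV KV v = -1)) = true := by
    decide +kernel
  intro v hv
  rw [List.all_eq_true] at h
  have h := h v hv
  simp only [Bool.and_eq_true, decide_eq_true_eq] at h
  refine ⟨by rw [ip_toC]; exact h.1, by rw [← KV_toC, ip_toC]; exact h.2⟩

/-! ### Bilinearity and reflections -/

theorem ip_comm (x y : Cls 8) : ip x y = ip y x := by
  simp [ip, mul_comm]

theorem ip_add_left (x y z : Cls 8) : ip (x + y) z = ip x z + ip y z := by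
  simp [ip, add_mul, Finset.sum_add_distrib]; ring

theorem ip_smul_left (c : ℤ) (x z : Cls 8) : ip (c • x) z = c * ip x z := by
  simp [ip, mul_sub, Finset.mul_sum, mul_assoc]

theorem ip_add_right (x y z : Cls 8) : ip z (x + y) = ip z x + ip z y := by
  rw [ip_comm, ip_add_left, ip_comm x, ip_comm y]

theorem ip_smul_right (c : ℤ) (x z : Cls 8) : ip z (c • x) = c * ip z x := by
  rw [ip_comm, ip_smul_left, ip_comm]

theorem ip_sub_left (x y z : Cls 8) : ip (x - y) z = ip x z - ip y z := by
  have := ip_add_left (x - y) y z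
  rw [sub_add_cancel] at this
  linarith

theorem ip_sub_right (x y z : Cls 8) : ip z (x - y) = ip z x - ip z y := by
  rw [ip_comm, ip_sub_left, ip_comm x, ip_comm y]

theorem ip_KK : ip (Kcls 8) (Kcls 8) = 1 := by
  simp [ip, Kcls]

/-- The reflection map in a class `r`. -/
def reflMap (r : Cls 8) : Cls 8 →ₗ[ℤ] Cls 8 where
  toFun z := z + ip z r • r
  map_add' x y := by rw [ip_add_left, add_smul]; abel
  map_smul' c x := by
    rw [ip_smul_left, RingHom.id_apply, smul_add, mul_smul]

theorem reflMap_apply (r z : Cls 8) : reflMap r z = z + ip z r • r := rfl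

/-- The reflection in a root `r`. -/
def rootRefl (r : Cls 8) (hr : ip r r = -2) : Cls 8 ≃ₗ[ℤ] Cls 8 :=
  LinearEquiv.ofInvolutive (reflMap r) fun z => by
    rw [reflMap_apply, reflMap_apply, ip_add_left, ip_smul_left, hr, add_assoc, ← add_smul]
    have : ip z r + (ip z r + ip z r * -2) = 0 := by ring
    rw [this, zero_smul, add_zero]

theorem refl_apply (r : Cls 8) (hr : ip r r = -2) (z : Cls 8) :
    rootRefl r hr z = z + ip z r • r := rfl

theorem refl_isWeyl (r : Cls 8) (hr : ip r r = -2) (hK : ip (Kcls 8) r = 0) :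
    IsWeyl (rootRefl r hr) := by
  constructor
  · intro x y
    simp only [refl_apply, ip_add_left, ip_add_right, ip_smul_left, ip_smul_right, hr,
      ip_comm r y]
    ring
  · rw [refl_apply, hK, zero_smul, add_zero]

theorem IsWeyl.trans {g h : Cls 8 ≃ₗ[ℤ] Cls 8} (hg : IsWeyl g) (hh : IsWeyl h) :
    IsWeyl (g.trans h) :=
  ⟨fun x y => by simp [hh.1, hg.1], by simp [hg.2, hh.2]⟩

theorem IsWeyl.symm {g : Cls 8 ≃ₗ[ℤ] Cls 8} (hg : IsWeyl g) : IsWeyl g.symm :=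
  ⟨fun x y => by rw [← hg.1]; simp, by rw [LinearEquiv.symm_apply_eq, hg.2]⟩

theorem IsWeyl.minusOne {g : Cls 8 ≃ₗ[ℤ] Cls 8} (hg : IsWeyl g) {x : Cls 8}
    (hx : IsMinusOne x) : IsMinusOne (g x) :=
  ⟨by rw [hg.1, hx.1], by
    have := hg.1 (Kcls 8) x
    rw [hg.2] at this
    rw [this, hx.2]⟩

/-- `x` and `y` are related by a Weyl element fixing all of `F`. -/
def Conn (F : List (Cls 8)) (x y : Cls 8) : Prop :=
  ∃ g : Cls 8 ≃ₗ[ℤ] Cls 8, IsWeyl g ∧ (∀ f ∈ F, g f = f) ∧ g x = y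

theorem Conn.refl (F : List (Cls 8)) (x : Cls 8) : Conn F x x :=
  ⟨LinearEquiv.refl ℤ _, ⟨fun _ _ => rfl, rfl⟩, fun _ _ => rfl, rfl⟩

theorem Conn.trans {F : List (Cls 8)} {x y z : Cls 8} (h : Conn F x y) (h' : Conn F y z) :
    Conn F x z := by
  obtain ⟨g, hg, hF, rfl⟩ := h
  obtain ⟨g', hg', hF', rfl⟩ := h'
  exact ⟨g.trans g', hg.trans hg', fun f hf => by simp [hF f hf, hF' f hf], rfl⟩

theorem Conn.symm {F : List (Cls 8)} {x y : Cls 8} (h : Conn F x y) : Conn F y x := by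
  obtain ⟨g, hg, hF, rfl⟩ := h
  exact ⟨g.symm, hg.symm, fun f hf => by rw [LinearEquiv.symm_apply_eq, hF f hf], by simp⟩

theorem Conn.step {F : List (Cls 8)} {x y : Cls 8} (hx : IsMinusOne x) (hy : IsMinusOne y)
    (hxy : ip x y = 0) (hF : ∀ f ∈ F, ip x f = ip y f) : Conn F x y := by
  have hr : ip (x - y) (x - y) = -2 := by
    rw [ip_sub_left, ip_sub_right, ip_sub_right, hx.1, hy.1, ip_comm y x, hxy]; rfl
  refine ⟨rootRefl (x - y) hr, refl_isWeyl _ _ ?_, ?_, ?_⟩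
  · rw [ip_sub_right, hx.2, hy.2]; rfl
  · intro f hf
    rw [refl_apply, ip_sub_right, ip_comm f x, ip_comm f y, hF f hf, sub_self, zero_smul,
      add_zero]
  · rw [refl_apply, ip_sub_right, hx.1, hxy]
    simp

/-! ### Connectedness by finite checks -/

def inS (F : List (V × ℤ)) (v : V) : Bool := F.all fun p => decide (ipV v p.1 = p.2)

def chk (F : List (V × ℤ)) (x0 : V) : Bool :=
  lits.all fun v => !(inS F v) || decide (v = x0) || decide (ipV v x0 = 0) ||
    (decide (0 < ipV v x0) && lits.any fun w =>
      decide (ipV w v = 0) && decide (ipV w x0 + 1 = ipV v x0) && inS F w)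

theorem inS_iff (F : List (V × ℤ)) (v : V) :
    inS F v = true ↔ ∀ p ∈ F, ip v.toC p.1.toC = p.2 := by
  simp [inS, ip_toC]

theorem conn_of_chk (F : List (V × ℤ)) (x0 : V) (h : chk F x0 = true) (h0 : x0 ∈ lits)
    (h0S : inS F x0 = true) :
    ∀ (n : ℕ) (v : V), v ∈ lits → inS F v = true → (ipV v x0).toNat = n →
      Conn (F.map fun p => p.1.toC) v.toC x0.toC := by
  have hF : ∀ v w, inS F v = true → inS F w = true →
      ∀ f ∈ F.map (fun p => p.1.toC), ip v.toC f = ip w.toC f := by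
    intro v w hv hw f hf
    rw [inS_iff] at hv hw
    obtain ⟨p, hp, rfl⟩ := List.mem_map.1 hf
    rw [hv p hp, hw p hp]
  rw [chk, List.all_eq_true] at h
  intro n
  induction n using Nat.strong_induction_on with
  | _ n ih =>
    intro v hv hvS hn
    have h := h v hv
    simp only [hvS, Bool.not_true, Bool.false_or, Bool.or_eq_true, decide_eq_true_eq,
      Bool.and_eq_true, List.any_eq_true] at h
    rcases h with (h | h) | ⟨hpos, w, hw, ⟨hwv, hwx⟩, hwS⟩
    · rw [h]; exact Conn.refl _ _
    · exact Conn.step (lits_minusOne v hv) (lits_minusOne x0 h0) (by rw [ip_toC, h])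
        (hF v x0 hvS h0S)
    · refine Conn.trans (Conn.step (lits_minusOne v hv) (lits_minusOne w hw)
        (by rw [ip_comm, ip_toC, hwv]) (hF v w hvS hwS)) ?_
      exact ih _ (by omega) w hw hwS rfl

theorem conn_cls (F : List (V × ℤ)) (x0 : V) (h : chk F x0 = true) (h0 : x0 ∈ lits)
    (h0S : inS F x0 = true) (x : Cls 8) (hx : IsMinusOne x)
    (hxF : ∀ p ∈ F, ip x p.1.toC = p.2) : Conn (F.map fun p => p.1.toC) x x0.toC := by
  obtain ⟨v, hv, rfl⟩ := mem_lits x hx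
  exact conn_of_chk F x0 h h0 h0S _ v hv ((inS_iff F v).2 hxF) rfl

def L0 : V := ⟨0, 0, 0, 0, 0, 0, 0, 0, -1⟩
def s0 : V := ⟨0, 0, 0, 0, 0, 0, 0, -1, 0⟩
def s1 : V := ⟨1, 0, 0, 0, 0, 0, 0, 1, 1⟩
def t0 : V := ⟨1, 0, 0, 0, 0, 0, 1, 1, 0⟩

theorem toL0 (x : Cls 8) (hx : IsMinusOne x) :
    ∃ g : Cls 8 ≃ₗ[ℤ] Cls 8, IsWeyl g ∧ g x = L0.toC := by
  obtain ⟨g, h1, -, h2⟩ := conn_cls [] L0 (by decide +kernel) (by decide +kernel)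
    (by decide +kernel) x hx (by simp)
  exact ⟨g, h1, h2⟩

theorem conn0 (x : Cls 8) (hx : IsMinusOne x) (h : ip x L0.toC = 0) :
    Conn [L0.toC] x s0.toC :=
  conn_cls [(L0, 0)] s0 (by decide +kernel) (by decide +kernel) (by decide +kernel) x hx
    (by simpa using h)

theorem conn1 (x : Cls 8) (hx : IsMinusOne x) (h : ip x L0.toC = 1) :
    Conn [L0.toC] x s1.toC :=
  conn_cls [(L0, 1)] s1 (by decide +kernel) (by decide +kernel) (by decide +kernel) x hx
    (by simpa using h)

theorem conn2 (x : Cls 8) (hx : IsMinusOne x) (h : ip x L0.toC = 0) (h' : ip x s0.toC = 1) :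
    Conn [L0.toC, s0.toC] x t0.toC :=
  conn_cls [(L0, 0), (s0, 1)] t0 (by decide +kernel) (by decide +kernel) (by decide +kernel)
    x hx (by simpa using ⟨h, h'⟩)

theorem bound (L x : Cls 8) (hL : IsMinusOne L) (hx : IsMinusOne x) :
    -1 ≤ ip x L ∧ ip x L ≤ 3 ∧ (ip x L = -1 → x = L) := by
  obtain ⟨g, hg, hgL⟩ := toL0 L hL
  obtain ⟨v, hv, hvx⟩ := mem_lits (g x) (hg.minusOne hx)
  have h : (lits.all fun v => decide (-1 ≤ ipV v L0) && decide (ipV v L0 ≤ 3) &&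
      (decide (ipV v L0 ≠ -1) || decide (v = L0))) = true := by decide +kernel
  rw [List.all_eq_true] at h
  have h := h v hv
  simp only [Bool.and_eq_true, Bool.or_eq_true, decide_eq_true_eq] at h
  rw [← hg.1, hgL, hvx, ip_toC]
  refine ⟨h.1.1, h.1.2, fun e => ?_⟩
  rcases h.2 with h | h
  · exact absurd e h
  · apply g.injective
    rw [hvx, hgL, h]

/-! ### Standard pairs -/

/-- The pairs `(x, y)` in standard position for `L`, of type `k`. -/
def Std (L x y : Cls 8) (k : ℤ) : Prop :=
  IsMinusOne x ∧ IsMinusOne y ∧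
    ((k = 11 ∧ x = L ∧ y = L) ∨ (k = 5 ∧ x = L ∧ ip y L = 0) ∨
     (k = 3 ∧ x = L ∧ ip y L = 1) ∨ (k = 1 ∧ ip x L = 0 ∧ ip y L = 0 ∧ ip x y = 1))

def baseX (k : ℤ) : V := if k = 1 then s0 else L0
def baseY (k : ℤ) : V := if k = 1 then t0 else if k = 3 then s1 else if k = 5 then s0 else L0

theorem std_base (L x y : Cls 8) (k : ℤ) (hL : IsMinusOne L) (h : Std L x y k) :
    ∃ g : Cls 8 ≃ₗ[ℤ] Cls 8, IsWeyl g ∧ g L = L0.toC ∧ g x = (baseX k).toC ∧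
      g y = (baseY k).toC := by
  obtain ⟨g, hg, hgL⟩ := toL0 L hL
  obtain ⟨hx, hy, h⟩ := h
  have hx' := hg.minusOne hx
  have hy' := hg.minusOne hy
  rcases h with ⟨rfl, rfl, rfl⟩ | ⟨rfl, rfl, h⟩ | ⟨rfl, rfl, h⟩ | ⟨rfl, h1, h2, h3⟩
  · exact ⟨g, hg, hgL, hgL, hgL⟩
  · obtain ⟨k, hk, hkF, hky⟩ := conn0 (g y) hy' (by rw [← hgL, hg.1, h])
    have hkL := hkF L0.toC (by simp)
    exact ⟨g.trans k, hg.trans hk, by simp [hgL, hkL], by simp [hgL, hkL, baseX],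
      by simp [hky, baseY]⟩
  · obtain ⟨k, hk, hkF, hky⟩ := conn1 (g y) hy' (by rw [← hgL, hg.1, h])
    have hkL := hkF L0.toC (by simp)
    exact ⟨g.trans k, hg.trans hk, by simp [hgL, hkL], by simp [hgL, hkL, baseX],
      by simp [hky, baseY]⟩
  · obtain ⟨k, hk, hkF, hkx⟩ := conn0 (g x) hx' (by rw [← hgL, hg.1, h1])
    have hkL := hkF L0.toC (by simp)
    obtain ⟨j, hj, hjF, hjy⟩ := conn2 (k (g y)) (hk.minusOne hy')
      (by rw [← hkL, hk.1, ← hgL, hg.1, h2])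
      (by rw [← hkx, hk.1, hg.1, ip_comm, h3])
    have hjL := hjF L0.toC (by simp)
    have hjs := hjF s0.toC (by simp)
    exact ⟨(g.trans k).trans j, (hg.trans hk).trans hj, by simp [hgL, hkL, hjL],
      by simp [hkx, hjs, baseX], by simp [hjy, baseY]⟩

theorem std_exists (L : Cls 8) (hL : IsMinusOne L) (k : ℤ)
    (hk : k = 11 ∨ k = 5 ∨ k = 3 ∨ k = 1) : ∃ x y, Std L x y k := by
  obtain ⟨g, hg, hgL⟩ := toL0 L hL
  have hLg : g.symm L0.toC = L := by rw [LinearEquiv.symm_apply_eq, hgL]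
  have m : ∀ v ∈ lits, IsMinusOne (g.symm v.toC) :=
    fun v hv => hg.symm.minusOne (lits_minusOne v hv)
  have e : ∀ v w : V, ip (g.symm v.toC) (g.symm w.toC) = ipV v w :=
    fun v w => by rw [hg.symm.1, ip_toC]
  have eL : ∀ v : V, ip (g.symm v.toC) L = ipV v L0 := fun v => by rw [← hLg, e]
  rcases hk with rfl | rfl | rfl | rfl
  · exact ⟨L, L, hL, hL, Or.inl ⟨rfl, rfl, rfl⟩⟩
  · exact ⟨L, g.symm s0.toC, hL, m _ (by decide +kernel),
      Or.inr (Or.inl ⟨rfl, rfl, by rw [eL]; decide⟩)⟩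
  · exact ⟨L, g.symm s1.toC, hL, m _ (by decide +kernel),
      Or.inr (Or.inr (Or.inl ⟨rfl, rfl, by rw [eL]; decide⟩))⟩
  · exact ⟨g.symm s0.toC, g.symm t0.toC, m _ (by decide +kernel), m _ (by decide +kernel),
      Or.inr (Or.inr (Or.inr ⟨rfl, by rw [eL]; decide, by rw [eL]; decide,
        by rw [e]; decide⟩))⟩

/-- The third class of a triple. -/
def third (L x y : Cls 8) : Cls 8 := (-2 : ℤ) • Kcls 8 + L - x - y

/-- The invariant separating the four orbits. -/
def inv (L : Cls 8) (m : Multiset (Cls 8)) : ℤ := (m.map fun x => ip x L * ip x L).sum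

theorem ip_third (L x y z : Cls 8) :
    ip (third L x y) z = -2 * ip (Kcls 8) z + ip L z - ip x z - ip y z := by
  rw [third, ip_sub_left, ip_sub_left, ip_add_left, ip_smul_left]

theorem third_minusOne (L x y : Cls 8) (k : ℤ) (hL : IsMinusOne L) (h : Std L x y k) :
    IsMinusOne (third L x y) := by
  obtain ⟨hx, hy, h⟩ := h
  have a1 := hx.1
  have a2 := hx.2
  have a3 := hy.1
  have a4 := hy.2
  have a5 := hL.1
  have a6 := hL.2
  have a7 := ip_KK
  constructor
  · rw [ip_third, ip_comm _ (third L x y), ip_comm _ (third L x y), ip_comm _ (third L x y),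
      ip_comm _ (third L x y)]
    simp only [ip_third]
    rw [ip_comm L (Kcls 8), ip_comm x (Kcls 8), ip_comm y (Kcls 8), ip_comm L x, ip_comm L y,
      ip_comm y x]
    rcases h with ⟨rfl, rfl, rfl⟩ | ⟨rfl, rfl, h⟩ | ⟨rfl, rfl, h⟩ | ⟨rfl, h1, h2, h3⟩
    · linarith
    · rw [ip_comm x y]; linarith
    · rw [ip_comm x y]; linarith
    · linarith
  · rw [ip_comm, ip_third, ip_comm L, ip_comm x, ip_comm y]
    linarith

theorem inv_std (L x y : Cls 8) (k : ℤ) (hL : IsMinusOne L) (h : Std L x y k) :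
    inv L {x, y, third L x y} = k := by
  obtain ⟨hx, hy, h⟩ := h
  have a5 := hL.1
  have a6 := hL.2
  simp only [inv, Multiset.insert_eq_cons, Multiset.map_cons, Multiset.map_singleton,
    Multiset.sum_cons, Multiset.sum_singleton, ip_third]
  rcases h with ⟨rfl, rfl, rfl⟩ | ⟨rfl, rfl, h⟩ | ⟨rfl, rfl, h⟩ | ⟨rfl, h1, h2, h3⟩
  · rw [a5, a6]; norm_num
  · rw [a5, a6, h]; norm_num
  · rw [a5, a6, h]; norm_num
  · rw [a5, a6, h1, h2]; norm_num

theorem exists_std_aux (L x y z : Cls 8) (hL : IsMinusOne L) (hx : IsMinusOne x)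
    (hy : IsMinusOne y) (hz : IsMinusOne z) (hs : x + y + z = (-2 : ℤ) • Kcls 8 + L)
    (hxy : ip x L ≤ ip y L) (hyz : ip y L ≤ ip z L) : ∃ k, Std L x y k := by
  obtain ⟨x1, x2, x3⟩ := bound L x hL hx
  obtain ⟨y1, y2, y3⟩ := bound L y hL hy
  obtain ⟨z1, z2, z3⟩ := bound L z hL hz
  have hsum : ip x L + ip y L + ip z L = 1 := by
    rw [← ip_add_left, ← ip_add_left, hs, ip_add_left, ip_smul_left, hL.1, hL.2]; norm_num
  rcases eq_or_lt_of_le x1 with e | e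
  · have hxL := x3 e.symm
    have : ip y L = -1 ∨ ip y L = 0 ∨ ip y L = 1 := by omega
    rcases this with h | h | h
    · exact ⟨11, hx, hy, Or.inl ⟨rfl, hxL, y3 h⟩⟩
    · exact ⟨5, hx, hy, Or.inr (Or.inl ⟨rfl, hxL, h⟩)⟩
    · exact ⟨3, hx, hy, Or.inr (Or.inr (Or.inl ⟨rfl, hxL, h⟩))⟩
  · have h1 : ip x L = 0 := by omega
    have h2 : ip y L = 0 := by omega
    refine ⟨1, hx, hy, Or.inr (Or.inr (Or.inr ⟨rfl, h1, h2, ?_⟩))⟩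
    have hzt : z = third L x y := by rw [third, ← hs]; abel
    have e1 : ip z x = -2 * -1 + 0 - -1 - ip x y := by
      rw [hzt, ip_third, hx.2, ip_comm L x, h1, hx.1, ip_comm y x]
    have e2 : ip z y = -2 * -1 + 0 - ip x y - -1 := by
      rw [hzt, ip_third, hy.2, ip_comm L y, h2, hy.1]
    have e3 : ip z z = -2 * -1 + ip z L - ip z x - ip z y := by
      conv_lhs => rw [hzt, ← hzt]
      have := ip_third L x y z
      rw [← hzt, hz.2, ip_comm L z, ip_comm x z, ip_comm y z] at this
      exact this
    have := hz.1
    omega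

theorem exists_std (L : Cls 8) (hL : IsMinusOne L) (m : Multiset (Cls 8))
    (hc : Multiset.card m = 3) (hm : ∀ x ∈ m, IsMinusOne x)
    (hs : m.sum = (-2 : ℤ) • Kcls 8 + L) :
    ∃ k x y, Std L x y k ∧ m = {x, y, third L x y} := by
  obtain ⟨x, y, z, rfl⟩ := Multiset.card_eq_three.1 hc
  have hx := hm x (by simp)
  have hy := hm y (by simp)
  have hz := hm z (by simp)
  have key : ∀ a b c : Cls 8, ({x, y, z} : Multiset (Cls 8)) = {a, b, c} → IsMinusOne a →
      IsMinusOne b → IsMinusOne c → ip a L ≤ ip b L → ip b L ≤ ip c L →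
      ∃ k x' y', Std L x' y' k ∧ ({x, y, z} : Multiset (Cls 8)) = {x', y', third L x' y'} := by
    intro a b c he ha hb hc' h1 h2
    rw [he] at hs
    have hs' : a + b + c = (-2 : ℤ) • Kcls 8 + L := by
      rw [← hs]; simp [add_assoc]
    obtain ⟨k, hk⟩ := exists_std_aux L a b c hL ha hb hc' hs' h1 h2
    refine ⟨k, a, b, hk, ?_⟩
    rw [he]
    have : c = third L a b := by rw [third, ← hs']; abel
    rw [← this]
  have p1 : ∀ a b c : Cls 8, ({a, b, c} : Multiset (Cls 8)) = {b, a, c} :=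
    fun a b c => Multiset.cons_swap _ _ _
  have p2 : ∀ a b c : Cls 8, ({a, b, c} : Multiset (Cls 8)) = {a, c, b} :=
    fun a b c => congrArg (a ::ₘ ·) (Multiset.pair_comm _ _)
  rcases le_total (ip x L) (ip y L) with h1 | h1 <;>
  rcases le_total (ip y L) (ip z L) with h2 | h2 <;>
  rcases le_total (ip x L) (ip z L) with h3 | h3
  · exact key x y z rfl hx hy hz h1 h2
  · exact key x y z rfl hx hy hz h1 h2
  · exact key x z y (p2 _ _ _) hx hz hy h3 h2
  · exact key z x y ((p2 _ _ _).trans (p1 _ _ _)) hz hx hy h3 h1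
  · exact key y x z (p1 _ _ _) hy hx hz h1 h3
  · exact key y z x ((p1 _ _ _).trans (p2 _ _ _)) hy hz hx h2 h3
  · exact key z y x (((p1 _ _ _).trans (p2 _ _ _)).trans (p1 _ _ _)) hz hy hx h2 h1
  · exact key z y x (((p1 _ _ _).trans (p2 _ _ _)).trans (p1 _ _ _)) hz hy hx h2 h1

/-- The stabilizer of a (−1)-class L in W₈ acts with exactly four orbits on
the set of unordered triples (multisets) of (−1)-classes summing to −2K + L. -/
theorem stmt12 (L : Cls 8) (hL : IsMinusOne L) :
    Nat.card (Quot (fun m m' :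
        {m : Multiset (Cls 8) // Multiset.card m = 3 ∧ (∀ x ∈ m, IsMinusOne x) ∧
          m.sum = (-2 : ℤ) • Kcls 8 + L} =>
      ∃ g : Cls 8 ≃ₗ[ℤ] Cls 8, IsWeyl g ∧ g L = L ∧
        Multiset.map (fun x => g x) m.1 = m'.1)) = 4 := by
  classical
  set X := {m : Multiset (Cls 8) // Multiset.card m = 3 ∧ (∀ x ∈ m, IsMinusOne x) ∧
          m.sum = (-2 : ℤ) • Kcls 8 + L} with hX
  set R : X → X → Prop := fun m m' => ∃ g : Cls 8 ≃ₗ[ℤ] Cls 8, IsWeyl g ∧ g L = L ∧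
        Multiset.map (fun x => g x) m.1 = m'.1 with hR
  have hinv : ∀ m m' : X, R m m' → inv L m.1 = inv L m'.1 := by
    rintro m m' ⟨g, hg, hgL, he⟩
    rw [← he, inv, inv, Multiset.map_map]
    congr 1
    refine Multiset.map_congr rfl fun x _ => ?_
    have : ip (g x) L = ip x L := by
      conv_lhs => rw [← hgL]
      exact hg.1 x L
    simp only [Function.comp, this]
  let f : Quot R → ℤ := Quot.lift (fun m => inv L m.1) hinv
  have hinj : Function.Injective f := by
    intro q q'
    induction q using Quot.ind with
    | mk m =>
    induction q' using Quot.ind with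
    | mk m' =>
    intro he
    replace he : inv L m.1 = inv L m'.1 := he
    obtain ⟨k, x, y, hk, hm⟩ := exists_std L hL m.1 m.2.1 m.2.2.1 m.2.2.2
    obtain ⟨k', x', y', hk', hm'⟩ := exists_std L hL m'.1 m'.2.1 m'.2.2.1 m'.2.2.2
    rw [hm, hm', inv_std L x y k hL hk, inv_std L x' y' k' hL hk'] at he
    subst he
    obtain ⟨g, hg, hgL, hgx, hgy⟩ := std_base L x y k hL hk
    obtain ⟨j, hj, hjL, hjx, hjy⟩ := std_base L x' y' k hL hk'
    have hw : IsWeyl (g.trans j.symm) := hg.trans hj.symm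
    have eL : (g.trans j.symm) L = L := by
      rw [LinearEquiv.trans_apply, hgL, ← hjL, LinearEquiv.symm_apply_apply]
    have ex : (g.trans j.symm) x = x' := by
      rw [LinearEquiv.trans_apply, hgx, ← hjx, LinearEquiv.symm_apply_apply]
    have ey : (g.trans j.symm) y = y' := by
      rw [LinearEquiv.trans_apply, hgy, ← hjy, LinearEquiv.symm_apply_apply]
    have et : (g.trans j.symm) (third L x y) = third L x' y' := by
      rw [third, map_sub, map_sub, map_add, map_smul, eL, ex, ey, hw.2, third]
    refine Quot.sound ⟨g.trans j.symm, hw, eL, ?_⟩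
    rw [hm, hm']
    simp only [Multiset.insert_eq_cons, Multiset.map_cons, Multiset.map_singleton, ex, ey, et]
  have hrange : Set.range f = (({11, 5, 3, 1} : Finset ℤ) : Set ℤ) := by
    ext k
    simp only [Finset.coe_insert, Finset.coe_singleton, Set.mem_insert_iff,
      Set.mem_singleton_iff]
    constructor
    · rintro ⟨q, rfl⟩
      induction q using Quot.ind with
      | mk m =>
      obtain ⟨k, x, y, hk, hm⟩ := exists_std L hL m.1 m.2.1 m.2.2.1 m.2.2.2
      have : f (Quot.mk R m) = k := by
        change inv L m.1 = k
        rw [hm, inv_std L x y k hL hk]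
      rw [this]
      obtain ⟨-, -, h⟩ := hk
      rcases h with h | h | h | h
      · exact Or.inl h.1
      · exact Or.inr (Or.inl h.1)
      · exact Or.inr (Or.inr (Or.inl h.1))
      · exact Or.inr (Or.inr (Or.inr h.1))
    · intro hk
      obtain ⟨x, y, h⟩ := std_exists L hL k hk
      have ht := third_minusOne L x y k hL h
      refine ⟨Quot.mk R ⟨{x, y, third L x y}, by simp, ?_, ?_⟩, inv_std L x y k hL h⟩
      · intro z hz
        simp only [Multiset.insert_eq_cons, Multiset.mem_cons, Multiset.mem_singleton] at hz
        rcases hz with rfl | rfl | rfl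
        · exact h.1
        · exact h.2.1
        · exact ht
      · simp only [Multiset.insert_eq_cons, Multiset.sum_cons, Multiset.sum_singleton, third]
        abel
  have h1 : Nat.card (Quot R) = Nat.card (Set.range f) :=
    Nat.card_congr (Equiv.ofInjective f hinj)
  rw [h1, hrange, Nat.card_coe_set_eq, Set.ncard_coe_finset]
  rfl
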